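/- arXiv:2602.15193 — 3 statements merged into one kernel-verified Lean document; each statement's English description precedes it below -/
import Mathlib

section
/- Let n ∈ ℕ and c ∈ ℝ³. The space (𝒫ⁿ)³ of vector-valued polynomial maps ℝ³ → ℝ³ of total degree at most n is the internal direct sum of the subspaces 𝒢ⁿ := {∇p : p ∈ 𝒫^{n+1}} and 𝒢ⁿ_c := {x ↦ q(x) × (x − c) : q ∈ (𝒫^{n−1})³}, i.e., every τ ∈ (𝒫ⁿ)³ decomposes uniquely as τ = ∇p + q × (x − c) with p ∈ 𝒫^{n+1} and q ∈ (𝒫^{n−1})³. -/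
open Matrix MeasureTheory
open scoped InnerProductSpace

noncomputable section

/-- Scalar polynomial functions `ℝ^d → ℝ` of total degree at most `n`. -/
def polySpace (d n : ℕ) : Submodule ℝ ((Fin d → ℝ) → ℝ) where
  carrier := {f | ∃ p : MvPolynomial (Fin d) ℝ,
    p.totalDegree ≤ n ∧ ∀ x, f x = MvPolynomial.eval x p}
  add_mem' := by
    rintro f g ⟨p, hp, hfp⟩ ⟨q, hq, hgq⟩
    exact ⟨p + q, le_trans (MvPolynomial.totalDegree_add p q) (max_le hp hq),
      fun x => by simp [hfp x, hgq x]⟩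
  zero_mem' := ⟨0, by simp, fun x => by simp⟩
  smul_mem' := by
    rintro a f ⟨p, hp, hfp⟩
    exact ⟨a • p, le_trans (MvPolynomial.totalDegree_smul_le a p) hp,
      fun x => by simp [hfp x, MvPolynomial.smul_eval]⟩

/-- Scalar polynomial functions of total degree at most `n` for `n : ℤ`,
with the convention that the space is `{0}` for negative `n`. -/
def polySpaceZ (d : ℕ) (n : ℤ) : Submodule ℝ ((Fin d → ℝ) → ℝ) :=
  if 0 ≤ n then polySpace d n.toNat else ⊥

/-- Vector-valued polynomial maps `ℝ^d → ℝ^d`, all of whose components are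
polynomial functions of total degree at most `n` (`n : ℤ`). -/
def vecPolySpaceZ (d : ℕ) (n : ℤ) : Submodule ℝ ((Fin d → ℝ) → (Fin d → ℝ)) where
  carrier := {f | ∀ i, (fun x => f x i) ∈ polySpaceZ d n}
  add_mem' := fun hf hg i => (polySpaceZ d n).add_mem (hf i) (hg i)
  zero_mem' := fun i => (polySpaceZ d n).zero_mem
  smul_mem' := fun a {f} hf i => (polySpaceZ d n).smul_mem a (hf i)

/-- The gradient `∇v = (∂₁v, …, ∂_d v)` of a scalar field. -/
def grad {d : ℕ} (v : (Fin d → ℝ) → ℝ) : (Fin d → ℝ) → (Fin d → ℝ) :=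
  fun x i => fderiv ℝ v x (Pi.single i 1)

/-- The divergence `div τ = Σᵢ ∂ᵢ τᵢ` of a vector field. -/
def divg {d : ℕ} (τ : (Fin d → ℝ) → (Fin d → ℝ)) : (Fin d → ℝ) → ℝ :=
  fun x => ∑ i, fderiv ℝ (fun y => τ y i) x (Pi.single i 1)

/-- The curl of a vector field on `ℝ³`. -/
def curl (v : (Fin 3 → ℝ) → (Fin 3 → ℝ)) : (Fin 3 → ℝ) → (Fin 3 → ℝ) :=
  fun x => ![fderiv ℝ (fun y => v y 2) x (Pi.single 1 1) - fderiv ℝ (fun y => v y 1) x (Pi.single 2 1),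
             fderiv ℝ (fun y => v y 0) x (Pi.single 2 1) - fderiv ℝ (fun y => v y 2) x (Pi.single 0 1),
             fderiv ℝ (fun y => v y 1) x (Pi.single 0 1) - fderiv ℝ (fun y => v y 0) x (Pi.single 1 1)]

/-- Rotation of a vector in `ℝ²` by `-π/2`: `(z₁, z₂)^⊥ = (z₂, -z₁)`. -/
def perp (z : Fin 2 → ℝ) : Fin 2 → ℝ := ![z 1, -z 0]

open MvPolynomial in
theorem aux_fderiv {d : ℕ} (c : Fin d → ℝ) (p : MvPolynomial (Fin d) ℝ) (x : Fin d → ℝ) :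
    HasFDerivAt (fun y => eval (y - c) p)
      (∑ i, eval (x - c) (pderiv i p) • ContinuousLinearMap.proj (R := ℝ) (φ := fun _ : Fin d => ℝ) i) x := by
  induction p using MvPolynomial.induction_on with
  | C a => simpa using hasFDerivAt_const a x
  | add p q hp hq =>
    simp only [map_add, add_smul, Finset.sum_add_distrib]
    exact hp.add hq
  | mul_X p j hp =>
    have hX : HasFDerivAt (fun y : Fin d → ℝ => (y - c) j)
        (ContinuousLinearMap.proj (R := ℝ) (φ := fun _ : Fin d => ℝ) j) x := by
      have := (ContinuousLinearMap.proj (R := ℝ) (φ := fun _ : Fin d => ℝ) j).hasFDerivAt (x := x)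
      simpa using this.sub_const (c j)
    have h := hp.mul hX
    simp only [map_mul, eval_X]
    refine h.congr_fderiv ?_
    ext v
    simp [Derivation.leibniz, pderiv_X, Pi.single_apply, add_mul, Finset.sum_add_distrib,
      Finset.mul_sum]
    congr 1
    · rw [Finset.sum_eq_single j]
      · simp
      · intro b _ hb; simp [hb.symm]
      · simp
    · exact Finset.sum_congr rfl fun i _ => by ring

open MvPolynomial in
theorem aux_grad {d : ℕ} (c : Fin d → ℝ) (p : MvPolynomial (Fin d) ℝ) (x : Fin d → ℝ) (i : Fin d) :
    grad (fun y => eval (y - c) p) x i = eval (x - c) (pderiv i p) := by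
  simp [grad, (aux_fderiv c p x).fderiv, Pi.single_apply]

open MvPolynomial in
theorem aux_shift_deg {d : ℕ} (c : Fin d → ℝ) (p : MvPolynomial (Fin d) ℝ) :
    (aeval (fun i => X i + C (c i)) p : MvPolynomial (Fin d) ℝ).totalDegree ≤ p.totalDegree := by
  rw [aeval_def, eval₂_eq]
  refine totalDegree_finsetSum_le fun s hs => ?_
  refine (totalDegree_mul _ _).trans ?_
  rw [algebraMap_eq, totalDegree_C, zero_add]
  refine (totalDegree_finsetProd _ _).trans ?_
  refine le_trans ?_ (le_totalDegree hs)
  refine Finset.sum_le_sum fun i _ => ?_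
  refine (totalDegree_pow _ _).trans ?_
  have : (X i + C (c i) : MvPolynomial (Fin d) ℝ).totalDegree ≤ 1 :=
    (totalDegree_add _ _).trans (by simp)
  simpa using Nat.mul_le_mul_left (s i) this

open MvPolynomial in
theorem aux_shift_eval {d : ℕ} (c : Fin d → ℝ) (p : MvPolynomial (Fin d) ℝ) (x : Fin d → ℝ) :
    eval x (aeval (fun i => X i + C (c i)) p : MvPolynomial (Fin d) ℝ) = eval (x + c) p := by
  induction p using MvPolynomial.induction_on with
  | C a => simp
  | add p q hp hq => simp only [map_add, hp, hq]
  | mul_X p j hp => simp only [map_mul, hp, aeval_X, eval_X, map_add, eval_C, Pi.add_apply]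

/-- Degree bound with integer index. -/
def DegZ (m : ℤ) (p : MvPolynomial (Fin 3) ℝ) : Prop :=
  p.totalDegree ≤ m.toNat ∧ (m < 0 → p = 0)

theorem DegZ.add {m : ℤ} {p q : MvPolynomial (Fin 3) ℝ} (hp : DegZ m p) (hq : DegZ m q) :
    DegZ m (p + q) :=
  ⟨(MvPolynomial.totalDegree_add _ _).trans (max_le hp.1 hq.1),
    fun h => by rw [hp.2 h, hq.2 h, add_zero]⟩

theorem DegZ.zero {m : ℤ} : DegZ m 0 := ⟨by simp, fun _ => rfl⟩

theorem DegZ.neg {m : ℤ} {p : MvPolynomial (Fin 3) ℝ} (hp : DegZ m p) : DegZ m (-p) :=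
  ⟨by rw [MvPolynomial.totalDegree_neg]; exact hp.1, fun h => by rw [hp.2 h, neg_zero]⟩

theorem DegZ.sub {m : ℤ} {p q : MvPolynomial (Fin 3) ℝ} (hp : DegZ m p) (hq : DegZ m q) :
    DegZ m (p - q) := by rw [sub_eq_add_neg]; exact hp.add hq.neg

theorem DegZ.C_mul {m : ℤ} {p : MvPolynomial (Fin 3) ℝ} (a : ℝ) (hp : DegZ m p) :
    DegZ m (MvPolynomial.C a * p) :=
  ⟨(MvPolynomial.totalDegree_mul _ _).trans (by simpa using hp.1),
    fun h => by rw [hp.2 h, mul_zero]⟩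

theorem DegZ.mul_X {m : ℤ} {p : MvPolynomial (Fin 3) ℝ} (hp : DegZ (m - 1) p) (i : Fin 3) :
    DegZ m (p * MvPolynomial.X i) := by
  by_cases h : m - 1 < 0
  · rw [hp.2 h, zero_mul]; exact DegZ.zero
  · refine ⟨(MvPolynomial.totalDegree_mul _ _).trans ?_, fun h' => by omega⟩
    have := hp.1
    rw [MvPolynomial.totalDegree_X]
    omega

theorem DegZ.sum {ι : Type*} {m : ℤ} {s : Finset ι} {p : ι → MvPolynomial (Fin 3) ℝ}
    (h : ∀ i ∈ s, DegZ m (p i)) : DegZ m (∑ i ∈ s, p i) :=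
  Finset.sum_induction _ (DegZ m) (fun _ _ => DegZ.add) DegZ.zero h

open MvPolynomial in
theorem aux_hom_pderiv {k n : ℕ} (hk : k ≤ n) {p : MvPolynomial (Fin 3) ℝ}
    (hp : p.IsHomogeneous k) (i : Fin 3) : DegZ ((n : ℤ) - 1) (pderiv i p) := by
  refine ⟨hp.pderiv.totalDegree_le.trans (by omega), fun h => ?_⟩
  have : k = 0 := by omega
  subst this
  rw [← totalDegree_zero_iff_isHomogeneous, totalDegree_eq_zero_iff_eq_C] at hp
  rw [hp, pderiv_C]

open MvPolynomial in
theorem aux_sum_hom {n : ℕ} {p : MvPolynomial (Fin 3) ℝ} (hp : p.totalDegree ≤ n) :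
    ∑ k ∈ Finset.range (n + 1), homogeneousComponent k p = p := by
  conv_rhs => rw [← sum_homogeneousComponent p]
  symm
  refine Finset.sum_subset (by simpa using hp) fun k _ hk => ?_
  exact homogeneousComponent_eq_zero _ _ (by simpa using hk)

open MvPolynomial in
theorem aux_pderiv {n : ℕ} {p : MvPolynomial (Fin 3) ℝ} (hp : p.totalDegree ≤ n) (i : Fin 3) :
    DegZ ((n : ℤ) - 1) (pderiv i p) := by
  rw [← aux_sum_hom hp, map_sum]
  exact DegZ.sum fun k hk => aux_hom_pderiv (by simpa [Nat.lt_succ_iff] using hk)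
    (homogeneousComponent_isHomogeneous k p) i

theorem mem_polySpaceZ (c : Fin 3 → ℝ) (m : ℤ) (f : (Fin 3 → ℝ) → ℝ) :
    f ∈ polySpaceZ 3 m ↔ ∃ p, DegZ m p ∧ f = fun x => MvPolynomial.eval (x - c) p := by
  unfold polySpaceZ DegZ
  split_ifs with h
  · constructor
    · rintro ⟨p, hp, hf⟩
      refine ⟨_, ⟨(aux_shift_deg c p).trans hp, fun h' => by omega⟩, ?_⟩
      funext x
      rw [aux_shift_eval, sub_add_cancel, hf]
    · rintro ⟨p, hp, rfl⟩
      refine ⟨_, (aux_shift_deg (-c) p).trans hp.1, fun x => ?_⟩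
      rw [aux_shift_eval, ← sub_eq_add_neg]
  · constructor
    · intro hf
      rw [Submodule.mem_bot] at hf
      exact ⟨0, by simp, by rw [hf]; funext x; simp⟩
    · rintro ⟨p, hp, rfl⟩
      rw [hp.2 (by omega), Submodule.mem_bot]
      funext x; simp

theorem mem_vecPolySpaceZ (c : Fin 3 → ℝ) (m : ℤ) (f : (Fin 3 → ℝ) → (Fin 3 → ℝ)) :
    f ∈ vecPolySpaceZ 3 m ↔ ∃ p : Fin 3 → MvPolynomial (Fin 3) ℝ, (∀ i, DegZ m (p i)) ∧
      f = fun x i => MvPolynomial.eval (x - c) (p i) := by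
  change (∀ i, (fun x => f x i) ∈ polySpaceZ 3 m) ↔ _
  simp only [mem_polySpaceZ c]
  constructor
  · intro h
    choose p hp hf using h
    exact ⟨p, hp, by funext x i; exact congrFun (hf i) x⟩
  · rintro ⟨p, hp, rfl⟩ i
    exact ⟨p i, hp i, rfl⟩

/-- Decomposability at the level of polynomials. -/
def Decomp (n : ℕ) (P : Fin 3 → MvPolynomial (Fin 3) ℝ) : Prop :=
  ∃ (p : MvPolynomial (Fin 3) ℝ) (Q : Fin 3 → MvPolynomial (Fin 3) ℝ),
    DegZ ((n : ℤ) + 1) p ∧ (∀ i, DegZ ((n : ℤ) - 1) (Q i)) ∧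
    ∀ i, P i = MvPolynomial.pderiv i p + crossProduct Q MvPolynomial.X i

theorem Decomp.add {n : ℕ} {P P' : Fin 3 → MvPolynomial (Fin 3) ℝ} (h : Decomp n P)
    (h' : Decomp n P') : Decomp n (P + P') := by
  obtain ⟨p, Q, hp, hQ, e⟩ := h
  obtain ⟨p', Q', hp', hQ', e'⟩ := h'
  refine ⟨p + p', Q + Q', hp.add hp', fun i => (hQ i).add (hQ' i), fun i => ?_⟩
  rw [Pi.add_apply, e, e', map_add, map_add, LinearMap.add_apply, Pi.add_apply]
  ring

theorem Decomp.zero {n : ℕ} : Decomp n 0 :=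
  ⟨0, 0, DegZ.zero, fun _ => DegZ.zero, fun i => by simp⟩

open MvPolynomial in
theorem aux_decomp_hom {k n : ℕ} (hk : k ≤ n) {P : Fin 3 → MvPolynomial (Fin 3) ℝ}
    (hP : ∀ i, (P i).IsHomogeneous k) : Decomp n P := by
  have ha : ((k : ℝ) + 1) ≠ 0 := by positivity
  have hD : ∀ i j, DegZ ((n : ℤ) - 1) (pderiv i (P j)) := fun i j => aux_hom_pderiv hk (hP j) i
  refine ⟨C ((k : ℝ) + 1)⁻¹ * (P 0 * X 0 + P 1 * X 1 + P 2 * X 2),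
    ![C ((k : ℝ) + 1)⁻¹ * (pderiv 1 (P 2) - pderiv 2 (P 1)),
      C ((k : ℝ) + 1)⁻¹ * (pderiv 2 (P 0) - pderiv 0 (P 2)),
      C ((k : ℝ) + 1)⁻¹ * (pderiv 0 (P 1) - pderiv 1 (P 0))], ?_, ?_, ?_⟩
  · have h0 : ∀ i, DegZ ((n : ℤ) + 1) (P i * X i) := fun i => by
      apply DegZ.mul_X
      exact ⟨(hP i).totalDegree_le.trans (by omega), fun h => by omega⟩
    exact (((h0 0).add (h0 1)).add (h0 2)).C_mul _
  · intro i
    fin_cases i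
    · exact ((hD _ _).sub (hD _ _)).C_mul _
    · exact ((hD _ _).sub (hD _ _)).C_mul _
    · exact ((hD _ _).sub (hD _ _)).C_mul _
  · have key : ∀ i, P i = C ((k : ℝ) + 1)⁻¹ * (P i + (X 0 * pderiv 0 (P i)
        + X 1 * pderiv 1 (P i) + X 2 * pderiv 2 (P i))) := fun i => by
      have := (hP i).sum_X_mul_pderiv
      rw [Fin.sum_univ_three] at this
      rw [this]
      have e : P i + k • P i = C ((k : ℝ) + 1) * P i := by
        rw [nsmul_eq_mul, map_add, map_natCast, C_1]; ring
      rw [e, ← mul_assoc, ← C_mul, inv_mul_cancel₀ ha, C_1, one_mul]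
    intro i
    fin_cases i
    · refine (key 0).trans ?_
      simp [cross_apply, Derivation.leibniz, pderiv_X, Pi.single_apply]
      ring
    · refine (key 1).trans ?_
      simp [cross_apply, Derivation.leibniz, pderiv_X, Pi.single_apply]
      ring
    · refine (key 2).trans ?_
      simp [cross_apply, Derivation.leibniz, pderiv_X, Pi.single_apply]
      ring

open MvPolynomial in
theorem aux_decomp {n : ℕ} {P : Fin 3 → MvPolynomial (Fin 3) ℝ}
    (hP : ∀ i, (P i).totalDegree ≤ n) : Decomp n P := by
  have : P = ∑ k ∈ Finset.range (n + 1), fun i => homogeneousComponent k (P i) := by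
    funext i
    rw [Finset.sum_apply, aux_sum_hom (hP i)]
  rw [this]
  exact Finset.sum_induction _ (Decomp n) (fun _ _ => Decomp.add) Decomp.zero fun k hk =>
    aux_decomp_hom (by simpa [Nat.lt_succ_iff] using hk)
      fun i => homogeneousComponent_isHomogeneous k (P i)

theorem eval_cross (Q : Fin 3 → MvPolynomial (Fin 3) ℝ) (y : Fin 3 → ℝ) (i : Fin 3) :
    MvPolynomial.eval y (crossProduct Q MvPolynomial.X i) =
      crossProduct (fun j => MvPolynomial.eval y (Q j)) y i := by
  fin_cases i <;> simp [cross_apply]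

open MvPolynomial in
/-- A gradient that is orthogonal to the radial direction vanishes. -/
theorem aux_uniq (c : Fin 3 → ℝ) (p : MvPolynomial (Fin 3) ℝ) (q : (Fin 3 → ℝ) → (Fin 3 → ℝ))
    (h : grad (fun y => eval (y - c) p) = fun x => crossProduct (q x) (x - c)) :
    grad (fun y => eval (y - c) p) = 0 := by
  have hconst : ∀ y, eval (y - c) p = eval 0 p := by
    intro y
    have hd : ∀ t : ℝ, HasDerivAt (fun t : ℝ => eval ((c + t • (y - c)) - c) p) 0 t := by
      intro t
      have h1 : HasDerivAt (fun t : ℝ => c + t • (y - c)) (y - c) t := by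
        simpa using ((hasDerivAt_id t).smul_const (y - c)).const_add c
      have h2 := (aux_fderiv c p (c + t • (y - c))).comp_hasDerivAt t h1
      refine h2.congr_deriv ?_
      have h3 : ∀ i, eval ((c + t • (y - c)) - c) (pderiv i p) =
          crossProduct (q (c + t • (y - c))) ((c + t • (y - c)) - c) i := fun i => by
        rw [← aux_grad, h]
      simp only [ContinuousLinearMap.sum_apply, ContinuousLinearMap.smul_apply, h3,
        ContinuousLinearMap.proj_apply, Fin.sum_univ_three]
      simp [cross_apply]
      ring
    have := is_const_of_deriv_eq_zero (fun t => (hd t).differentiableAt) (fun t => (hd t).deriv) 1 0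
    simpa using this
  have : (fun y => eval (y - c) p) = fun _ => eval 0 p := funext hconst
  rw [this]
  funext x i
  simp [grad]

/-- `(𝒫ⁿ)³ = 𝒢ⁿ ⊕ 𝒢ⁿ_c` in `ℝ³`: every vector polynomial `τ` of total
degree at most `n` decomposes uniquely as `τ = ∇p + (x ↦ q x × (x - c))` with
`p ∈ 𝒫^{n+1}` and `q ∈ (𝒫^{n-1})³`. -/
theorem statement0 (n : ℕ) (c : Fin 3 → ℝ) :
    let G : Set ((Fin 3 → ℝ) → (Fin 3 → ℝ)) :=
      {f | ∃ p ∈ polySpaceZ 3 ((n : ℤ) + 1), f = grad p}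
    let Gc : Set ((Fin 3 → ℝ) → (Fin 3 → ℝ)) :=
      {f | ∃ q ∈ vecPolySpaceZ 3 ((n : ℤ) - 1),
        f = fun x => crossProduct (q x) (x - c)}
    G ⊆ (vecPolySpaceZ 3 (n : ℤ) : Set _) ∧
    Gc ⊆ (vecPolySpaceZ 3 (n : ℤ) : Set _) ∧
    ∀ τ ∈ vecPolySpaceZ 3 (n : ℤ), ∃ g ∈ G, ∃ h ∈ Gc,
      τ = g + h ∧ ∀ g' ∈ G, ∀ h' ∈ Gc, τ = g' + h' → g' = g ∧ h' = h := by
  intro G Gc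
  refine ⟨?_, ?_, ?_⟩
  · rintro f ⟨p, hp, rfl⟩
    obtain ⟨P, hP, rfl⟩ := (mem_polySpaceZ c _ _).1 hp
    refine (mem_vecPolySpaceZ c _ _).2 ⟨fun i => MvPolynomial.pderiv i P, fun i => ?_, ?_⟩
    · have := aux_pderiv (n := n + 1) (p := P) (by have := hP.1; omega) i
      simpa using this
    · funext x i
      exact aux_grad c P x i
  · rintro f ⟨q, hq, rfl⟩
    obtain ⟨Q, hQ, rfl⟩ := (mem_vecPolySpaceZ c _ _).1 hq
    refine (mem_vecPolySpaceZ c _ _).2 ⟨crossProduct Q MvPolynomial.X, fun i => ?_, ?_⟩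
    · rw [cross_apply]
      fin_cases i
      · exact ((hQ _).mul_X _).sub ((hQ _).mul_X _)
      · exact ((hQ _).mul_X _).sub ((hQ _).mul_X _)
      · exact ((hQ _).mul_X _).sub ((hQ _).mul_X _)
    · funext x i
      rw [eval_cross]
  · intro τ hτ
    obtain ⟨P, hP, rfl⟩ := (mem_vecPolySpaceZ c _ _).1 hτ
    obtain ⟨p, Q, hp, hQ, e⟩ := aux_decomp (n := n) (P := P)
      (fun i => by have := (hP i).1; simpa using this)
    refine ⟨_, ⟨fun x => MvPolynomial.eval (x - c) p, (mem_polySpaceZ c _ _).2 ⟨p, hp, rfl⟩, rfl⟩,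
      _, ⟨_, (mem_vecPolySpaceZ c _ _).2 ⟨Q, hQ, rfl⟩, rfl⟩, ?_, ?_⟩
    · funext x i
      rw [Pi.add_apply, Pi.add_apply, aux_grad, e, map_add, eval_cross]
    · rintro g' ⟨p', hp', rfl⟩ h' ⟨q', hq', rfl⟩ e'
      obtain ⟨p', hp'', rfl⟩ := (mem_polySpaceZ c _ _).1 hp'
      have e2 : (fun x i => MvPolynomial.eval (x - c) (P i)) =
          grad (fun x => MvPolynomial.eval (x - c) p) +
          fun x => crossProduct (fun i => MvPolynomial.eval (x - c) (Q i)) (x - c) := by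
        funext x i
        rw [Pi.add_apply, Pi.add_apply, aux_grad, e, map_add, eval_cross]
      have hsub : grad (fun x => MvPolynomial.eval (x - c) (p' - p)) =
          grad (fun x => MvPolynomial.eval (x - c) p') -
          grad (fun x => MvPolynomial.eval (x - c) p) := by
        funext x i
        rw [Pi.sub_apply, Pi.sub_apply, aux_grad, aux_grad, aux_grad, map_sub, map_sub]
      have e3 := e'.symm.trans e2
      have hz := aux_uniq c (p' - p)
        (fun x => (fun i => MvPolynomial.eval (x - c) (Q i)) - q' x) (by
          rw [hsub]
          have : grad (fun x => MvPolynomial.eval (x - c) p') -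
              grad (fun x => MvPolynomial.eval (x - c) p) =
              (fun x => crossProduct (fun i => MvPolynomial.eval (x - c) (Q i)) (x - c)) -
              fun x => crossProduct (q' x) (x - c) := by
            rw [sub_eq_sub_iff_add_eq_add, e3, add_comm]
          rw [this]
          funext x
          rw [Pi.sub_apply, map_sub crossProduct, LinearMap.sub_apply])
      rw [hsub, sub_eq_zero] at hz
      refine ⟨hz, ?_⟩
      rw [hz] at e3
      exact add_left_cancel e3

end
end

section
/- Let n ∈ ℕ, n ≥ 1, and c ∈ ℝ³. Then {x ↦ q(x) × (x − c) : q ∈ (𝒫^{n−1})³} = {x ↦ (curl v)(x) × (x − c) : v ∈ (𝒫ⁿ)³}, i.e., the space 𝒢ⁿ_c obtained by crossing vector polynomials of degree at most n−1 with (x − c) coincides with the space obtained by crossing elements of 𝒞^{n−1} := curl((𝒫ⁿ)³) with (x − c). -/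
open Matrix MeasureTheory
open scoped InnerProductSpace

noncomputable section

section helpers
open MvPolynomial

lemma hasF (p : MvPolynomial (Fin 3) ℝ) (x : Fin 3 → ℝ) :
    HasFDerivAt (fun y : Fin 3 → ℝ => MvPolynomial.eval y p)
      (∑ i, (MvPolynomial.eval x (pderiv i p)) • ContinuousLinearMap.proj (R := ℝ) (φ := fun _ : Fin 3 => ℝ) i) x := by
  induction p using MvPolynomial.induction_on with
  | C a => simpa using hasFDerivAt_const a x
  | add p q hp hq =>
    have := hp.add hq
    simp only [map_add, add_smul, Finset.sum_add_distrib]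
    exact this
  | mul_X p j hp =>
    have := hp.mul (ContinuousLinearMap.proj (R := ℝ) (φ := fun _ : Fin 3 => ℝ) j).hasFDerivAt (x := x)
    simp only [map_mul, eval_X]
    refine this.congr_fderiv ?_
    ext v
    fin_cases j <;> simp [Fin.sum_univ_three, pderiv_X, Pi.single_apply] <;> ring

lemma fderiv_eval (p : MvPolynomial (Fin 3) ℝ) (x : Fin 3 → ℝ) (i : Fin 3) :
    fderiv ℝ (fun y : Fin 3 → ℝ => MvPolynomial.eval y p) x (Pi.single i 1)
      = MvPolynomial.eval x (pderiv i p) := by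
  rw [(hasF p x).fderiv]
  fin_cases i <;> simp [Fin.sum_univ_three]

lemma deg_pderiv (p : MvPolynomial (Fin 3) ℝ) (i : Fin 3) (m : ℕ) (h : p.totalDegree ≤ m + 1) :
    (pderiv i p).totalDegree ≤ m := by
  refine Finset.sup_le fun s hs => ?_
  rw [mem_support_iff, coeff_pderiv] at hs
  have h1 : s + Finsupp.single i 1 ∈ p.support := by
    rw [mem_support_iff]; intro h0; simp [h0] at hs
  have h2 : (s + Finsupp.single i 1).degree ≤ m + 1 := (le_totalDegree h1).trans h
  change s.degree ≤ m
  rw [map_add, Finsupp.degree_single] at h2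
  omega

/-- shifted Euler operator plus two -/
def eulerOp (c : Fin 3 → ℝ) (p : MvPolynomial (Fin 3) ℝ) : MvPolynomial (Fin 3) ℝ :=
  2 * p + ∑ i, (X i - C (c i)) * pderiv i p

lemma eulerOp_add (c : Fin 3 → ℝ) (p q) : eulerOp c (p + q) = eulerOp c p + eulerOp c q := by
  simp [eulerOp, Fin.sum_univ_three]; ring

lemma X_mul_pd (s : Fin 3 →₀ ℕ) (a : ℝ) (i : Fin 3) :
    X i * pderiv i (monomial s a) = monomial s (a * s i) := by
  rw [X_mul_pderiv_monomial, smul_monomial, nsmul_eq_mul, mul_comm]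

lemma degree_eq (s : Fin 3 →₀ ℕ) : s.degree = s 0 + s 1 + s 2 := by
  rw [Finsupp.degree_eq_sum]; simp [Fin.sum_univ_three]

lemma solve_monomial (c : Fin 3 → ℝ) (k : ℕ) : ∀ (s : Fin 3 →₀ ℕ) (a : ℝ), s.degree = k →
    ∃ p, p.totalDegree ≤ k ∧ eulerOp c p = monomial s a := by
  induction k using Nat.strong_induction_on with
  | _ k ih =>
    intro s a hs
    have key : ∀ (i : Fin 3) (b : ℝ), ∃ p, p.totalDegree ≤ k ∧
        eulerOp c p = C (c i) * pderiv i (monomial s b) := by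
      intro i b
      by_cases h : s i = 0
      · exact ⟨0, by simp, by simp [eulerOp, pderiv_monomial, h]⟩
      · have hlt : (s - Finsupp.single i 1).degree < k := by
          rw [degree_eq] at *
          fin_cases i <;> simp at * <;> omega
        obtain ⟨p, hp, he⟩ := ih _ hlt (s - Finsupp.single i 1) (c i * (b * s i)) rfl
        exact ⟨p, by omega, by rw [he, pderiv_monomial, C_mul_monomial]⟩
    set b : ℝ := a / (2 + k) with hb
    have hk : (2 + k : ℝ) ≠ 0 := by positivity
    obtain ⟨p0, h0, e0⟩ := key 0 b
    obtain ⟨p1, h1, e1⟩ := key 1 b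
    obtain ⟨p2, h2, e2⟩ := key 2 b
    refine ⟨monomial s b + p0 + p1 + p2, ?_, ?_⟩
    · have hm : (monomial s b).totalDegree ≤ k := by
        refine (totalDegree_monomial_le s b).trans ?_
        rw [← hs]; rfl
      refine (totalDegree_add _ _).trans (max_le ((totalDegree_add _ _).trans (max_le ((totalDegree_add _ _).trans (max_le hm h0)) h1)) h2)
    · rw [eulerOp_add, eulerOp_add, eulerOp_add, e0, e1, e2, eulerOp]
      simp only [Fin.sum_univ_three, sub_mul, X_mul_pd]
      have h2 : (2 : MvPolynomial (Fin 3) ℝ) * monomial s b = monomial s (2 * b) := by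
        rw [← C_mul_monomial]; rfl
      have : a = 2 * b + b * s 0 + b * s 1 + b * s 2 := by
        have : (k : ℝ) = s 0 + s 1 + s 2 := by rw [← hs, degree_eq]; push_cast; ring
        rw [hb]; field_simp; rw [this]; ring
      rw [this, h2, map_add, map_add, map_add]
      ring

lemma solve (c : Fin 3 → ℝ) (m : ℕ) (q : MvPolynomial (Fin 3) ℝ) (hq : q.totalDegree ≤ m) :
    ∃ p, p.totalDegree ≤ m ∧ eulerOp c p = q := by
  suffices h : ∀ t : Finset (Fin 3 →₀ ℕ), t ⊆ q.support → ∃ p, p.totalDegree ≤ m ∧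
      eulerOp c p = ∑ s ∈ t, monomial s (coeff s q) by
    obtain ⟨p, hp, he⟩ := h q.support subset_rfl
    exact ⟨p, hp, by rw [he, support_sum_monomial_coeff]⟩
  intro t
  induction t using Finset.induction_on with
  | empty => exact fun _ => ⟨0, by simp, by simp [eulerOp]⟩
  | insert s t hs ih =>
    intro hst
    rw [Finset.insert_subset_iff] at hst
    obtain ⟨p, hp, he⟩ := ih hst.2
    obtain ⟨p', hp', he'⟩ := solve_monomial c s.degree s (coeff s q) rfl
    have : s.degree ≤ m := (le_totalDegree hst.1).trans hq
    exact ⟨p' + p, (totalDegree_add _ _).trans (max_le (hp'.trans this) hp), by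
      rw [eulerOp_add, he, he', Finset.sum_insert hs]⟩

lemma vec_iff (m : ℕ) (q : (Fin 3 → ℝ) → (Fin 3 → ℝ)) : q ∈ vecPolySpaceZ 3 (m : ℤ) ↔
    ∃ P : Fin 3 → MvPolynomial (Fin 3) ℝ, (∀ i, (P i).totalDegree ≤ m) ∧
      q = fun x i => MvPolynomial.eval x (P i) := by
  have : q ∈ vecPolySpaceZ 3 (m : ℤ) ↔ ∀ i, ∃ p : MvPolynomial (Fin 3) ℝ,
    p.totalDegree ≤ m ∧ ∀ x, q x i = MvPolynomial.eval x p := by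
    change (∀ i, (fun x => q x i) ∈ polySpaceZ 3 (m : ℤ)) ↔ _
    simp only [polySpaceZ, Int.natCast_nonneg, if_true, Int.toNat_natCast]
    rfl
  rw [this]
  constructor
  · intro h
    choose P h1 h2 using h
    exact ⟨P, h1, by ext x i; exact h2 i x⟩
  · rintro ⟨P, h1, rfl⟩ i
    exact ⟨P i, h1 i, fun _ => rfl⟩

lemma deg_sub {m : ℕ} {p q : MvPolynomial (Fin 3) ℝ} (hp : p.totalDegree ≤ m)
    (hq : q.totalDegree ≤ m) : (p - q).totalDegree ≤ m :=
  (totalDegree_sub _ _).trans (max_le hp hq)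

end helpers

/-- For `n ≥ 1` and `c ∈ ℝ³`,
`{x ↦ q x × (x - c) : q ∈ (𝒫^{n-1})³} = {x ↦ (curl v) x × (x - c) : v ∈ (𝒫ⁿ)³}`. -/
theorem statement3 (n : ℕ) (hn : 1 ≤ n) (c : Fin 3 → ℝ) :
    {f : (Fin 3 → ℝ) → (Fin 3 → ℝ) | ∃ q ∈ vecPolySpaceZ 3 ((n : ℤ) - 1),
        f = fun x => crossProduct (q x) (x - c)} =
    {f : (Fin 3 → ℝ) → (Fin 3 → ℝ) | ∃ v ∈ vecPolySpaceZ 3 (n : ℤ),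
        f = fun x => crossProduct (curl v x) (x - c)} := by
  obtain ⟨m, rfl⟩ : ∃ m, n = m + 1 := ⟨n - 1, by omega⟩
  have e : ((m + 1 : ℕ) : ℤ) - 1 = (m : ℤ) := by push_cast; ring
  rw [e]
  ext f
  simp only [Set.mem_setOf_eq, vec_iff]
  constructor
  · rintro ⟨_, ⟨Q, hQ, rfl⟩, rfl⟩
    choose P hP heP using fun i => solve c m (Q i) (hQ i)
    let Y : Fin 3 → MvPolynomial (Fin 3) ℝ :=
      fun i => MvPolynomial.X i - MvPolynomial.C (c i)
    have hY : ∀ i, (Y i).totalDegree ≤ 1 := fun i => deg_sub (by simp) (by simp)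
    have hPY : ∀ i j, (P i * Y j).totalDegree ≤ m + 1 := fun i j =>
      (MvPolynomial.totalDegree_mul _ _).trans (add_le_add (hP i) (hY j))
    refine ⟨_, ⟨![P 1 * Y 2 - P 2 * Y 1, P 2 * Y 0 - P 0 * Y 2, P 0 * Y 1 - P 1 * Y 0], ?_, rfl⟩, ?_⟩
    · intro i
      fin_cases i <;> exact deg_sub (hPY _ _) (hPY _ _)
    · funext x
      simp only [curl, fderiv_eval]
      have h0 := congrArg (MvPolynomial.eval x) (heP 0)
      have h1 := congrArg (MvPolynomial.eval x) (heP 1)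
      have h2 := congrArg (MvPolynomial.eval x) (heP 2)
      simp [eulerOp, Fin.sum_univ_three] at h0 h1 h2
      ext i
      fin_cases i <;>
        simp [cross_apply, Y, MvPolynomial.pderiv_X, Pi.single_apply, ← h0, ← h1, ← h2] <;> ring
  · rintro ⟨_, ⟨V, hV, rfl⟩, rfl⟩
    refine ⟨_, ⟨![MvPolynomial.pderiv 1 (V 2) - MvPolynomial.pderiv 2 (V 1),
      MvPolynomial.pderiv 2 (V 0) - MvPolynomial.pderiv 0 (V 2),
      MvPolynomial.pderiv 0 (V 1) - MvPolynomial.pderiv 1 (V 0)], ?_, rfl⟩, ?_⟩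
    · intro i
      fin_cases i <;> exact deg_sub (deg_pderiv _ _ _ (hV _)) (deg_pderiv _ _ _ (hV _))
    · funext x
      simp only [curl, fderiv_eval]
      congr 2
      ext i
      fin_cases i <;> simp

end
end

section
/- Let d ≥ 1, n ≥ 1 and c ∈ ℝ^d. The linear map 𝒫^{n−1} → 𝒫^{n−1} sending a polynomial p to the divergence of the vector field x ↦ p(x)(x − c), i.e., p ↦ d·p + ⟨∇p(·), · − c⟩, is well-defined and is a linear automorphism of 𝒫^{n−1}. In particular, for every p ∈ 𝒫^{n−1} there exists a vector field τ of the form τ(x) = q(x)(x − c) with q ∈ 𝒫^{n−1} such that div τ = p. -/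
open Matrix MeasureTheory
open scoped InnerProductSpace

noncomputable section

namespace Aux6
open MvPolynomial

lemma hasFDerivAt_eval {d : ℕ} (P : MvPolynomial (Fin d) ℝ) (x : Fin d → ℝ) :
    DifferentiableAt ℝ (fun y => eval y P) x ∧
      ∀ i, fderiv ℝ (fun y => eval y P) x (Pi.single i 1) = eval x (pderiv i P) := by
  induction P using MvPolynomial.induction_on with
  | C a => simp
  | add p q hp hq =>
    refine ⟨by simp only [map_add]; exact hp.1.fun_add hq.1, fun i => ?_⟩
    simp only [map_add]
    rw [fderiv_fun_add hp.1 hq.1]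
    simp [hp.2, hq.2]
  | mul_X p j hp =>
    have hX : DifferentiableAt ℝ (fun y : Fin d → ℝ => y j) x := by fun_prop
    refine ⟨by simp only [map_mul, eval_X]; exact hp.1.fun_mul hX, fun i => ?_⟩
    simp only [map_mul, eval_X]
    have h2 : fderiv ℝ (fun y : Fin d → ℝ => y j) x = ContinuousLinearMap.proj j :=
      (ContinuousLinearMap.proj (R := ℝ) (φ := fun _ : Fin d => ℝ) j).fderiv
    rw [fderiv_fun_mul hp.1 hX, h2]
    simp [hp.2, pderiv_mul, pderiv_X, Pi.single_apply]
    by_cases h : i = j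
    · subst h; simp
    · simp [h, Ne.symm h]

def T0 {d : ℕ} (P : MvPolynomial (Fin d) ℝ) : MvPolynomial (Fin d) ℝ :=
  C (d : ℝ) * P + ∑ i, X i * pderiv i P

lemma coeff_T0 {d : ℕ} (P : MvPolynomial (Fin d) ℝ) (m : Fin d →₀ ℕ) :
    coeff m (T0 P) = ((d : ℝ) + ∑ i, (m i : ℝ)) * coeff m P := by
  induction P using MvPolynomial.induction_on' with
  | monomial u a =>
    simp only [T0, X_mul_pderiv_monomial, coeff_add, coeff_C_mul, coeff_sum, coeff_smul,
      coeff_monomial]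
    by_cases h : u = m
    · subst h; simp [add_mul, Finset.sum_mul]
    · simp [h]
  | add p q hp hq =>
    have : T0 (p + q) = T0 p + T0 q := by
      simp [T0, mul_add, Finset.sum_add_distrib]; ring
    rw [this, coeff_add, hp, hq, coeff_add]; ring

lemma pos_fac {d : ℕ} (hd : 1 ≤ d) (m : Fin d →₀ ℕ) : ((d : ℝ) + ∑ i, (m i : ℝ)) ≠ 0 := by
  have : (1 : ℝ) ≤ d := by exact_mod_cast hd
  have h2 : 0 ≤ ∑ i, (m i : ℝ) := Finset.sum_nonneg fun i _ => by positivity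
  linarith

lemma T0_deg {d : ℕ} (hd : 1 ≤ d) (P : MvPolynomial (Fin d) ℝ) :
    (T0 P).totalDegree = P.totalDegree := by
  have : (T0 P).support = P.support := by
    ext m; simp [mem_support_iff, coeff_T0, pos_fac hd m]
  rw [totalDegree, this, totalDegree]

lemma T0_inj {d : ℕ} (hd : 1 ≤ d) {P Q : MvPolynomial (Fin d) ℝ} (h : T0 P = T0 Q) : P = Q := by
  ext m
  have := congrArg (coeff m) h
  rw [coeff_T0, coeff_T0] at this
  exact mul_left_cancel₀ (pos_fac hd m) this

lemma T0_surj {d : ℕ} (hd : 1 ≤ d) (P : MvPolynomial (Fin d) ℝ) : ∃ Q, T0 Q = P := by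
  classical
  refine ⟨∑ m ∈ P.support, monomial m (((d : ℝ) + ∑ i, (m i : ℝ))⁻¹ * coeff m P), ?_⟩
  ext m
  rw [coeff_T0, coeff_sum]
  simp only [coeff_monomial, Finset.sum_ite_eq']
  split_ifs with h
  · rw [mul_inv_cancel_left₀ (pos_fac hd m)]
  · rw [notMem_support_iff.mp h, mul_zero]

def shift {d : ℕ} (c : Fin d → ℝ) (P : MvPolynomial (Fin d) ℝ) : MvPolynomial (Fin d) ℝ :=
  aeval (fun i => X i - C (c i)) P

lemma eval_shift {d : ℕ} (c x : Fin d → ℝ) (P : MvPolynomial (Fin d) ℝ) :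
    eval x (shift c P) = eval (x - c) P := by
  induction P using MvPolynomial.induction_on with
  | C a => simp [shift]
  | add p q hp hq => simp only [shift, map_add] at *; rw [hp, hq]
  | mul_X p j hp => simp only [shift, map_mul] at *; rw [hp]; simp

lemma shift_deg {d : ℕ} (c : Fin d → ℝ) (P : MvPolynomial (Fin d) ℝ) :
    (shift c P).totalDegree ≤ P.totalDegree := by
  rw [shift, aeval_def, eval₂_eq]
  refine totalDegree_finsetSum_le fun m hm => ?_
  refine (totalDegree_mul _ _).trans ?_
  rw [algebraMap_eq, totalDegree_C, zero_add]
  refine (totalDegree_finsetProd _ _).trans (le_trans ?_ (le_totalDegree hm))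
  refine Finset.sum_le_sum fun i _ => (totalDegree_pow _ _).trans ?_
  have : (X i - C (c i) : MvPolynomial (Fin d) ℝ).totalDegree ≤ 1 :=
    (totalDegree_sub_C_le _ _).trans (totalDegree_X i).le
  exact (Nat.mul_le_mul_left _ this).trans (by simp)

lemma mem_iff {d N : ℕ} (c : Fin d → ℝ) (f : (Fin d → ℝ) → ℝ) :
    f ∈ polySpace d N ↔ ∃ P : MvPolynomial (Fin d) ℝ,
      P.totalDegree ≤ N ∧ f = fun x => eval (x - c) P := by
  constructor
  · rintro ⟨P, hP, h⟩
    refine ⟨shift (-c) P, (shift_deg _ _).trans hP, ?_⟩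
    funext x; rw [h, eval_shift]; simp
  · rintro ⟨P, hP, rfl⟩
    exact ⟨shift c P, (shift_deg _ _).trans hP, fun x => (eval_shift c x P).symm⟩

lemma diff_sub {d : ℕ} (c x : Fin d → ℝ) (P : MvPolynomial (Fin d) ℝ) :
    DifferentiableAt ℝ (fun y => eval (y - c) P) x := by
  have h : (fun y => eval (y - c) P) = fun y => eval y (shift c P) :=
    funext fun y => (eval_shift c y P).symm
  rw [h]; exact (hasFDerivAt_eval _ x).1

lemma grad_sub {d : ℕ} (c x : Fin d → ℝ) (P : MvPolynomial (Fin d) ℝ) (i : Fin d) :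
    grad (fun y => eval (y - c) P) x i = eval (x - c) (pderiv i P) := by
  rw [grad, fderiv_comp_sub (f := fun y => eval y P) (𝕜 := ℝ) c]
  exact (hasFDerivAt_eval P (x - c)).2 i

lemma T_eq {d : ℕ} (c : Fin d → ℝ) (P : MvPolynomial (Fin d) ℝ) :
    (fun x => (d : ℝ) * eval (x - c) P +
      ∑ i, grad (fun y => eval (y - c) P) x i * (x i - c i)) =
    fun x => eval (x - c) (T0 P) := by
  funext x
  simp [T0, grad_sub, mul_comm]

lemma div_eq {d : ℕ} (c : Fin d → ℝ) (P : MvPolynomial (Fin d) ℝ) :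
    divg (fun x => eval (x - c) P • (x - c)) = fun x => eval (x - c) (T0 P) := by
  rw [← T_eq]
  funext x
  have key : ∀ i, fderiv ℝ (fun y : Fin d → ℝ => (eval (y - c) P • (y - c)) i) x (Pi.single i 1)
      = eval (x - c) P + grad (fun y => eval (y - c) P) x i * (x i - c i) := by
    intro i
    have hX : DifferentiableAt ℝ (fun y : Fin d → ℝ => y i - c i) x := by fun_prop
    have h2 : fderiv ℝ (fun y : Fin d → ℝ => y i - c i) x = ContinuousLinearMap.proj i := by
      rw [fderiv_sub_const]
      exact (ContinuousLinearMap.proj (R := ℝ) (φ := fun _ : Fin d => ℝ) i).fderiv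
    simp only [Pi.smul_apply, Pi.sub_apply, smul_eq_mul]
    rw [fderiv_fun_mul (diff_sub c x P) hX, h2]
    simp [grad, mul_comm]
  simp only [divg, key, Finset.sum_add_distrib]
  simp

end Aux6

/-- For `d, n ≥ 1` and `c ∈ ℝ^d`, the linear map
`p ↦ d·p + ⟨∇p(·), · - c⟩` maps `𝒫^{n-1}` into itself, is linear there, and is a
bijection of `𝒫^{n-1}` onto itself.  In particular every `p ∈ 𝒫^{n-1}` is the
divergence of a field `x ↦ q x • (x - c)` with `q ∈ 𝒫^{n-1}`. -/
theorem statement6 (d n : ℕ) (hd : 1 ≤ d) (hn : 1 ≤ n) (c : Fin d → ℝ) :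
    let T : ((Fin d → ℝ) → ℝ) → ((Fin d → ℝ) → ℝ) :=
      fun p x => (d : ℝ) * p x + ∑ i, grad p x i * (x i - c i)
    let S : Set ((Fin d → ℝ) → ℝ) := (polySpace d (n - 1) : Set _)
    (∀ p ∈ S, T p ∈ S) ∧
    (∀ p ∈ S, ∀ q ∈ S, T (p + q) = T p + T q) ∧
    (∀ (a : ℝ), ∀ p ∈ S, T (a • p) = a • T p) ∧
    Set.BijOn T S S ∧
    (∀ p ∈ S, ∃ q ∈ S, divg (fun x => q x • (x - c)) = p) := by
  intro T S
  have hT : ∀ P : MvPolynomial (Fin d) ℝ, T (fun x => MvPolynomial.eval (x - c) P) =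
      fun x => MvPolynomial.eval (x - c) (Aux6.T0 P) := fun P => Aux6.T_eq c P
  have hS : ∀ f, f ∈ S ↔ ∃ P : MvPolynomial (Fin d) ℝ,
      P.totalDegree ≤ n - 1 ∧ f = fun x => MvPolynomial.eval (x - c) P :=
    fun f => Aux6.mem_iff c f
  have hmap : ∀ p ∈ S, T p ∈ S := by
    intro p hp
    obtain ⟨P, hP, rfl⟩ := (hS p).1 hp
    exact (hS _).2 ⟨Aux6.T0 P, (Aux6.T0_deg hd P).le.trans hP, hT P⟩
  have hdiff : ∀ p ∈ S, ∀ x, DifferentiableAt ℝ p x := by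
    intro p hp x
    obtain ⟨P, hP, rfl⟩ := (hS p).1 hp
    exact Aux6.diff_sub c x P
  have hsurj : ∀ p ∈ S, ∃ P : MvPolynomial (Fin d) ℝ, P.totalDegree ≤ n - 1 ∧
      (fun x => MvPolynomial.eval (x - c) (Aux6.T0 P)) = p := by
    intro p hp
    obtain ⟨P, hP, rfl⟩ := (hS p).1 hp
    obtain ⟨Q, rfl⟩ := Aux6.T0_surj hd P
    exact ⟨Q, (Aux6.T0_deg hd Q).ge.trans hP, rfl⟩
  refine ⟨hmap, ?_, ?_, ⟨hmap, ?_, ?_⟩, ?_⟩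
  · intro p hp q hq
    funext x
    simp only [T, grad, Pi.add_apply, fderiv_add (hdiff p hp x) (hdiff q hq x),
      _root_.add_apply, add_mul, Finset.sum_add_distrib]
    ring
  · intro a p hp
    funext x
    simp only [T, grad, Pi.smul_apply, fderiv_const_smul (hdiff p hp x),
      _root_.smul_apply, smul_eq_mul, mul_add, Finset.mul_sum, mul_assoc]
    ring
  · intro p hp q hq h
    obtain ⟨P, hP, rfl⟩ := (hS p).1 hp
    obtain ⟨Q, hQ, rfl⟩ := (hS q).1 hq
    rw [hT, hT] at h
    have : Aux6.T0 P = Aux6.T0 Q := by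
      refine MvPolynomial.funext fun x => ?_
      simpa using congrFun h (x + c)
    rw [Aux6.T0_inj hd this]
  · intro p hp
    obtain ⟨P, hP, h⟩ := hsurj p hp
    exact ⟨_, (hS _).2 ⟨P, hP, rfl⟩, (hT P).trans h⟩
  · intro p hp
    obtain ⟨P, hP, h⟩ := hsurj p hp
    exact ⟨_, (hS _).2 ⟨P, hP, rfl⟩, (Aux6.div_eq c P).trans h⟩

end
end
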